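/- Let d ∈ ℕ, m ∈ {0,1,2}, K_m, K_{m+1} ∈ [1,∞), let T : C([0,1]^d,ℝ) → C([0,1]^d,ℝ) be a linear map with ‖Tg‖_∞ ≤ ‖g‖_∞ for all g ∈ C([0,1]^d,ℝ), and let U_n : C([0,1]^d,ℝ) → C([0,1]^d,ℝ), n ∈ ℕ, be linear maps such that: (a) for every n ∈ ℕ and every f ∈ C^m([0,1]^d,ℝ), U_n f ∈ C^m([0,1]^d,ℝ) and ‖U_n f‖_{C^m} ≤ K_m ‖f‖_{C^m}; (b) for every n ∈ ℕ and every f ∈ C^{m+1}([0,1]^d,ℝ), U_n f ∈ C^{m+1}([0,1]^d,ℝ) and ‖U_n f‖_{C^{m+1}} ≤ K_{m+1} ‖f‖_{C^{m+1}}; (c) for every f ∈ C([0,1]^d,ℝ), lim_{n→∞} ‖Tf − U_n f‖_∞ = 0. Then for every f ∈ C^m([0,1]^d,ℝ) it holds that Tf ∈ C^m([0,1]^d,ℝ) and ‖Tf‖_{C^m} ≤ K_m ‖f‖_{C^m}. -/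

import Mathlib

open MeasureTheory Filter

noncomputable section

/-- The unit cube `[0,1]^d` in `ℝ^d`. -/
def cube (d : ℕ) : Set (Fin d → ℝ) := Set.univ.pi fun _ => Set.Icc (0:ℝ) 1

/-- Partial derivative in coordinate `i` (within `[0,1]`, i.e. one-sided at the boundary). -/
def pd (d : ℕ) (i : Fin d) (g : (Fin d → ℝ) → ℝ) : (Fin d → ℝ) → ℝ :=
  fun x => derivWithin (fun t => g (Function.update x i t)) (Set.Icc (0:ℝ) 1) (x i)

/-- Iterated partial derivative `∂^α` (coordinates applied in a fixed order). -/
def mderiv (d : ℕ) (α : Fin d → ℕ) (f : (Fin d → ℝ) → ℝ) : (Fin d → ℝ) → ℝ :=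
  List.foldr (fun i g => (pd d i)^[α i] g) f (List.finRange d)

/-- `f ∈ C^m([0,1]^d, ℝ)`: all partial derivatives of order `0` through `m` exist
(one-sidedly at the boundary) and are continuous on the cube. -/
def MemCm (d : ℕ) : ℕ → ((Fin d → ℝ) → ℝ) → Prop
  | 0, f => ContinuousOn f (cube d)
  | m + 1, f => ContinuousOn f (cube d) ∧ ∀ i : Fin d,
      (∀ x ∈ cube d, DifferentiableWithinAt ℝ (fun t => f (Function.update x i t))
        (Set.Icc (0:ℝ) 1) (x i)) ∧
      MemCm d m (pd d i f)

/-- Sup norm over the cube: `‖g‖_∞ = sup_{x ∈ [0,1]^d} |g(x)|`. -/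
def supCube (d : ℕ) (g : (Fin d → ℝ) → ℝ) : ℝ := ⨆ x : cube d, |g x.1|

/-- The `C^m`-norm: `max_{|α| ≤ m} sup_{x ∈ [0,1]^d} |∂^α f(x)|`. -/
def CmNorm (d m : ℕ) (f : (Fin d → ℝ) → ℝ) : ℝ :=
  ⨆ α : {α : Fin d → ℕ // (∑ i, α i) ≤ m}, supCube d (mderiv d α.1 f)

/-- `λ_m := max_{0 < |α| ≤ m} ∑_i ‖∂^α b_i‖_∞`. -/
def lamNorm (d m : ℕ) (b : Fin d → (Fin d → ℝ) → ℝ) : ℝ :=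
  ⨆ α : {α : Fin d → ℕ // 0 < (∑ i, α i) ∧ (∑ i, α i) ≤ m},
    ∑ i, supCube d (mderiv d α.1 (b i))

section CubeCalculus

variable {d : ℕ}

open scoped Topology Convolution ContDiff

/-! ### The cube and coordinate lines -/

lemma isCompact_cube (d : ℕ) : IsCompact (cube d) :=
  isCompact_univ_pi fun _ => isCompact_Icc

lemma mem_cube_iff {x : Fin d → ℝ} : x ∈ cube d ↔ ∀ i, x i ∈ Set.Icc (0 : ℝ) 1 := by
  simp only [cube, Set.mem_univ_pi]

lemma zero_mem_cube : (0 : Fin d → ℝ) ∈ cube d := mem_cube_iff.2 fun i => by simp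

lemma update_mem_cube {x : Fin d → ℝ} (hx : x ∈ cube d) (i : Fin d) {t : ℝ}
    (ht : t ∈ Set.Icc (0 : ℝ) 1) : Function.update x i t ∈ cube d := by
  rw [mem_cube_iff] at hx ⊢
  intro j
  rcases eq_or_ne j i with rfl | hj
  · simpa using ht
  · simpa [hj] using hx j

lemma ContinuousOn.comp_update {f : (Fin d → ℝ) → ℝ} (hf : ContinuousOn f (cube d))
    {x : Fin d → ℝ} (hx : x ∈ cube d) (i : Fin d) :
    ContinuousOn (fun t => f (Function.update x i t)) (Set.Icc (0 : ℝ) 1) :=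
  hf.comp (by fun_prop) fun _ ht => update_mem_cube hx i ht

lemma exists_abs_le_of_continuousOn_cube {f : (Fin d → ℝ) → ℝ} (hf : ContinuousOn f (cube d)) :
    ∃ C, 0 ≤ C ∧ ∀ x ∈ cube d, |f x| ≤ C := by
  obtain ⟨C, hC⟩ := (isCompact_cube d).exists_bound_of_continuousOn hf
  exact ⟨C, (norm_nonneg _).trans (hC 0 zero_mem_cube), hC⟩

lemma abs_le_supCube {f : (Fin d → ℝ) → ℝ} (hf : ContinuousOn f (cube d)) {x : Fin d → ℝ}
    (hx : x ∈ cube d) : |f x| ≤ supCube d f := by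
  obtain ⟨C, -, hC⟩ := exists_abs_le_of_continuousOn_cube hf
  exact le_ciSup (f := fun x : cube d => |f x.1|)
    ⟨C, by rintro _ ⟨y, rfl⟩; exact hC y y.2⟩ ⟨x, hx⟩

lemma supCube_le {f : (Fin d → ℝ) → ℝ} {C : ℝ} (h : ∀ x ∈ cube d, |f x| ≤ C) :
    supCube d f ≤ C :=
  have : Nonempty (cube d) := ⟨0, zero_mem_cube⟩
  ciSup_le fun x => h x x.2

/-- The function `f` has the partial derivative `h` in direction `i` on the cube. -/
def HasPartial (i : Fin d) (f h : (Fin d → ℝ) → ℝ) : Prop :=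
  ∀ x ∈ cube d, HasDerivWithinAt (fun t => f (Function.update x i t)) (h x) (Set.Icc 0 1) (x i)

lemma HasPartial.pd_eqOn {i : Fin d} {f h : (Fin d → ℝ) → ℝ} (H : HasPartial i f h) :
    Set.EqOn (pd d i f) h (cube d) := fun x hx =>
  (H x hx).derivWithin (uniqueDiffOn_Icc_zero_one _ (mem_cube_iff.1 hx i))

lemma HasPartial.hasDerivWithinAt {i : Fin d} {f h : (Fin d → ℝ) → ℝ} (H : HasPartial i f h)
    {x : Fin d → ℝ} (hx : x ∈ cube d) {t : ℝ} (ht : t ∈ Set.Icc (0 : ℝ) 1) :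
    HasDerivWithinAt (fun s => f (Function.update x i s)) (h (Function.update x i t))
      (Set.Icc 0 1) t := by
  simpa using H _ (update_mem_cube hx i ht)

lemma HasPartial.sub {i : Fin d} {f g h k : (Fin d → ℝ) → ℝ} (H : HasPartial i f h)
    (K : HasPartial i g k) : HasPartial i (f - g) (h - k) := fun x hx =>
  (H x hx).sub (K x hx)

/-- Partial differentiability expressed through the fundamental theorem of calculus. -/
lemma hasPartial_iff_integral {i : Fin d} {f h : (Fin d → ℝ) → ℝ} (hh : ContinuousOn h (cube d)) :
    HasPartial i f h ↔ ∀ x ∈ cube d, ∀ t ∈ Set.Icc (0 : ℝ) 1,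
      ∫ s in (0 : ℝ)..t, h (Function.update x i s) =
        f (Function.update x i t) - f (Function.update x i 0) := by
  have hint : ∀ x ∈ cube d, ∀ t ∈ Set.Icc (0 : ℝ) 1,
      IntervalIntegrable (fun s => h (Function.update x i s)) volume 0 t := fun x hx t ht =>
    ((hh.comp_update hx i).mono (by
      rw [Set.uIcc_of_le ht.1]; exact Set.Icc_subset_Icc_right ht.2)).intervalIntegrable
  constructor
  · intro H x hx t ht
    refine intervalIntegral.integral_eq_sub_of_hasDerivAt_of_le ht.1
      (f := fun s => f (Function.update x i s)) ?_ ?_ (hint x hx t ht)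
    · exact fun s hs => ((H.hasDerivWithinAt hx ⟨hs.1, hs.2.trans ht.2⟩).continuousWithinAt).mono
        (Set.Icc_subset_Icc_right ht.2)
    · intro s hs
      have hs' : s < 1 := hs.2.trans_le ht.2
      exact (H.hasDerivWithinAt hx ⟨hs.1.le, hs'.le⟩).hasDerivAt (Icc_mem_nhds hs.1 hs')
  · intro H x hx
    have hxi := mem_cube_iff.1 hx i
    have : Fact (x i ∈ Set.Icc (0 : ℝ) 1) := ⟨hxi⟩
    have hc := hh.comp_update hx i
    have key := intervalIntegral.integral_hasDerivWithinAt_right (s := Set.Icc 0 1)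
      (t := Set.Icc 0 1) (hint x hx _ hxi)
      (hc.stronglyMeasurableAtFilter_nhdsWithin measurableSet_Icc _) (hc _ hxi)
    simp only [Function.update_eq_self] at key
    refine (key.add_const (f (Function.update x i 0))).congr_of_mem (fun t ht => ?_) hxi
    simp [H x hx t ht]

lemma pd_congr {f g : (Fin d → ℝ) → ℝ} (h : Set.EqOn f g (cube d)) (i : Fin d) :
    Set.EqOn (pd d i f) (pd d i g) (cube d) := fun _ hx =>
  derivWithin_congr (fun _ ht => h (update_mem_cube hx i ht))
    (h (update_mem_cube hx i (mem_cube_iff.1 hx i)))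

lemma pd_const_smul (c : ℝ) (f : (Fin d → ℝ) → ℝ) (i : Fin d) :
    pd d i (c • f) = c • pd d i f := by
  ext x
  simpa [pd] using derivWithin_fun_const_smul_field (𝕝 := ℝ) c
    (fun t => f (Function.update x i t))

/-! ### Iterated partial derivatives along words -/

/-- Iterated partial derivative along a word of coordinates, the head being applied first. -/
def wordDeriv : List (Fin d) → ((Fin d → ℝ) → ℝ) → (Fin d → ℝ) → ℝ
  | [], f => f
  | i :: w, f => wordDeriv w (pd d i f)

lemma wordDeriv_append (u v : List (Fin d)) (f : (Fin d → ℝ) → ℝ) :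
    wordDeriv (u ++ v) f = wordDeriv v (wordDeriv u f) := by
  induction u generalizing f with
  | nil => rfl
  | cons i u ih => exact ih _

lemma wordDeriv_congr (w : List (Fin d)) {f g : (Fin d → ℝ) → ℝ} (h : Set.EqOn f g (cube d)) :
    Set.EqOn (wordDeriv w f) (wordDeriv w g) (cube d) := by
  induction w generalizing f g with
  | nil => exact h
  | cons i w ih => exact ih (pd_congr h i)

lemma wordDeriv_const_smul (w : List (Fin d)) (c : ℝ) (f : (Fin d → ℝ) → ℝ) :
    wordDeriv w (c • f) = c • wordDeriv w f := by
  induction w generalizing f with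
  | nil => rfl
  | cons i w ih => simp only [wordDeriv, pd_const_smul, ih]

lemma wordDeriv_replicate (n : ℕ) (i : Fin d) (f : (Fin d → ℝ) → ℝ) :
    wordDeriv (List.replicate n i) f = (pd d i)^[n] f := by
  induction n generalizing f with
  | zero => rfl
  | succ n ih => exact ih _

/-- Multi-index derivatives are derivatives along words with the prescribed multiplicities. -/
lemma exists_word_mderiv (α : Fin d → ℕ) :
    ∃ w : List (Fin d), (∀ f, mderiv d α f = wordDeriv w f) ∧ ∀ i, w.count i = α i := by
  have key : ∀ L : List (Fin d), ∃ w : List (Fin d),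
      (∀ f, List.foldr (fun i g => (pd d i)^[α i] g) f L = wordDeriv w f) ∧
        ∀ i, w.count i = L.count i * α i := by
    intro L
    induction L with
    | nil => exact ⟨[], fun f => rfl, by simp⟩
    | cons j L ih =>
      obtain ⟨w, hw, hc⟩ := ih
      refine ⟨w ++ List.replicate (α j) j, fun f => ?_, fun i => ?_⟩
      · rw [List.foldr_cons, hw, wordDeriv_append, wordDeriv_replicate]
      · rw [List.count_append, hc, List.count_replicate, List.count_cons]
        rcases eq_or_ne j i with rfl | h
        · simp; ring
        · simp [h]
  obtain ⟨w, hw, hc⟩ := key (List.finRange d)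
  refine ⟨w, hw, fun i => ?_⟩
  rw [hc, List.count_eq_one_of_mem (List.nodup_finRange d) (List.mem_finRange i), one_mul]

lemma length_eq_sum_count (w : List (Fin d)) : w.length = ∑ i, w.count i := by
  simpa using (Multiset.sum_count_eq_card (s := Finset.univ) (m := (w : Multiset (Fin d)))
    (by simp)).symm

/-! ### Functions of class `C^m` -/

lemma MemCm.continuousOn {m : ℕ} {f : (Fin d → ℝ) → ℝ} (hf : MemCm d m f) :
    ContinuousOn f (cube d) := by
  cases m with
  | zero => exact hf
  | succ m => exact hf.1

lemma MemCm.pd {m : ℕ} {f : (Fin d → ℝ) → ℝ} (hf : MemCm d (m + 1) f) (i : Fin d) :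
    MemCm d m (pd d i f) := (hf.2 i).2

lemma MemCm.hasPartial {m : ℕ} {f : (Fin d → ℝ) → ℝ} (hf : MemCm d (m + 1) f) (i : Fin d) :
    HasPartial i f (_root_.pd d i f) := fun x hx => ((hf.2 i).1 x hx).hasDerivWithinAt

lemma MemCm.of_succ {m : ℕ} {f : (Fin d → ℝ) → ℝ} (hf : MemCm d (m + 1) f) : MemCm d m f := by
  induction m generalizing f with
  | zero => exact hf.1
  | succ m ih => exact ⟨hf.1, fun i => ⟨(hf.2 i).1, ih (hf.2 i).2⟩⟩

lemma MemCm.congr {m : ℕ} {f g : (Fin d → ℝ) → ℝ} (hf : MemCm d m f)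
    (h : Set.EqOn g f (cube d)) : MemCm d m g := by
  induction m generalizing f g with
  | zero => exact ContinuousOn.congr hf h
  | succ m ih =>
    refine ⟨hf.1.congr h, fun i => ⟨fun x hx => ?_, ih (hf.pd i) (pd_congr h i)⟩⟩
    exact ((hf.2 i).1 x hx).congr (fun t ht => h (update_mem_cube hx i ht))
      (h (update_mem_cube hx i (mem_cube_iff.1 hx i)))

lemma memCm_succ_of_hasPartial {m : ℕ} {f : (Fin d → ℝ) → ℝ} (hf : ContinuousOn f (cube d))
    (h : ∀ i, ∃ g, HasPartial i f g ∧ MemCm d m g) : MemCm d (m + 1) f := by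
  refine ⟨hf, fun i => ?_⟩
  obtain ⟨g, hg, hgm⟩ := h i
  exact ⟨fun x hx => (hg x hx).differentiableWithinAt, hgm.congr hg.pd_eqOn⟩

lemma MemCm.sub {m : ℕ} {f g : (Fin d → ℝ) → ℝ} (hf : MemCm d m f) (hg : MemCm d m g) :
    MemCm d m (f - g) := by
  induction m generalizing f g with
  | zero => exact ContinuousOn.sub hf hg
  | succ m ih =>
    exact memCm_succ_of_hasPartial (hf.1.sub hg.1) fun i =>
      ⟨_, (hf.hasPartial i).sub (hg.hasPartial i), ih (hf.pd i) (hg.pd i)⟩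

lemma MemCm.wordDeriv {m : ℕ} (w : List (Fin d)) {f : (Fin d → ℝ) → ℝ}
    (hf : MemCm d (m + w.length) f) : MemCm d m (wordDeriv w f) := by
  induction w generalizing f with
  | nil => exact hf
  | cons i w ih => exact ih (MemCm.pd (m := m + w.length) hf i)

lemma MemCm.of_le {k m : ℕ} (h : k ≤ m) {f : (Fin d → ℝ) → ℝ} (hf : MemCm d m f) :
    MemCm d k f := by
  induction m, h using Nat.le_induction with
  | base => exact hf
  | succ m _ ih => exact ih hf.of_succ

lemma MemCm.continuousOn_wordDeriv {m : ℕ} {w : List (Fin d)} (hw : w.length ≤ m)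
    {f : (Fin d → ℝ) → ℝ} (hf : MemCm d m f) : ContinuousOn (_root_.wordDeriv w f) (cube d) :=
  MemCm.wordDeriv (m := 0) w (hf.of_le (by simpa using hw))

lemma wordDeriv_sub {m : ℕ} {w : List (Fin d)} (hw : w.length ≤ m) {f g : (Fin d → ℝ) → ℝ}
    (hf : MemCm d m f) (hg : MemCm d m g) :
    Set.EqOn (wordDeriv w (f - g)) (wordDeriv w f - wordDeriv w g) (cube d) := by
  induction w generalizing m f g with
  | nil => exact fun _ _ => rfl
  | cons i w ih =>
    obtain _ | m := m
    · simp at hw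
    · refine (wordDeriv_congr w ((hf.hasPartial i).sub (hg.hasPartial i)).pd_eqOn).trans ?_
      exact ih (by simpa using hw) (hf.pd i) (hg.pd i)

/-! ### Uniform limits -/

lemma UniformCauchySeqOn.exists_tendstoUniformlyOn {g : ℕ → (Fin d → ℝ) → ℝ}
    {s : Set (Fin d → ℝ)} (hg : UniformCauchySeqOn g atTop s) :
    ∃ h, TendstoUniformlyOn g h atTop s := by
  have : ∀ x, ∃ a, x ∈ s → Tendsto (fun n => g n x) atTop (𝓝 a) := by
    intro x
    by_cases hx : x ∈ s
    · obtain ⟨a, ha⟩ := cauchySeq_tendsto_of_complete (hg.cauchySeq hx)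
      exact ⟨a, fun _ => ha⟩
    · exact ⟨0, fun h => absurd h hx⟩
  choose h hh using this
  exact ⟨h, hg.tendstoUniformlyOn_of_tendsto hh⟩

lemma HasPartial.of_tendstoUniformlyOn {i : Fin d} {g g' : ℕ → (Fin d → ℝ) → ℝ}
    {f h : (Fin d → ℝ) → ℝ} (hg : ∀ n, HasPartial i (g n) (g' n))
    (hc : ∀ n, ContinuousOn (g' n) (cube d))
    (hf : ∀ x ∈ cube d, Tendsto (fun n => g n x) atTop (𝓝 (f x)))
    (hh : TendstoUniformlyOn g' h atTop (cube d)) : HasPartial i f h := by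
  have hhc : ContinuousOn h (cube d) := hh.continuousOn (Frequently.of_forall hc)
  rw [hasPartial_iff_integral hhc]
  intro x hx t ht
  have hsub : Set.uIcc 0 t ⊆ Set.Icc (0 : ℝ) 1 := by
    rw [Set.uIcc_of_le ht.1]; exact Set.Icc_subset_Icc_right ht.2
  have hlim : Tendsto (fun n => ∫ s in (0 : ℝ)..t, g' n (Function.update x i s)) atTop
      (𝓝 (∫ s in (0 : ℝ)..t, h (Function.update x i s))) := by
    refine TendstoUniformlyOn.tendsto_intervalIntegral_of_continuousOn ?_ ?_
    · exact Eventually.of_forall fun n =>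
        ((hc n).comp_update hx i).mono hsub
    · exact (hh.comp (Function.update x i)).mono fun s hs => update_mem_cube hx i (hsub hs)
  refine tendsto_nhds_unique hlim ?_
  have h0 : (0 : ℝ) ∈ Set.Icc (0 : ℝ) 1 := ⟨le_rfl, zero_le_one⟩
  refine ((hf _ (update_mem_cube hx i ht)).sub (hf _ (update_mem_cube hx i h0))).congr fun n => ?_
  exact ((hasPartial_iff_integral (hc n)).1 (hg n) x hx t ht).symm

/-- Completeness of `C^m`: a sequence whose derivatives up to order `m` are uniformly Cauchy
and which converges pointwise to `f` converges to `f` in `C^m`. -/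
lemma memCm_of_uniformCauchySeqOn {m : ℕ} {g : ℕ → (Fin d → ℝ) → ℝ} {f : (Fin d → ℝ) → ℝ}
    (hg : ∀ n, MemCm d m (g n))
    (hc : ∀ w : List (Fin d), w.length ≤ m →
      UniformCauchySeqOn (fun n => wordDeriv w (g n)) atTop (cube d))
    (hf : ∀ x ∈ cube d, Tendsto (fun n => g n x) atTop (𝓝 (f x))) :
    MemCm d m f ∧ ∀ w : List (Fin d), w.length ≤ m →
      TendstoUniformlyOn (fun n => wordDeriv w (g n)) (wordDeriv w f) atTop (cube d) := by
  induction m generalizing g f with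
  | zero =>
    have hu : TendstoUniformlyOn g f atTop (cube d) :=
      (hc [] le_rfl).tendstoUniformlyOn_of_tendsto hf
    refine ⟨hu.continuousOn (Frequently.of_forall hg), fun w hw => ?_⟩
    obtain rfl : w = [] := List.length_eq_zero_iff.1 (Nat.le_zero.1 hw)
    exact hu
  | succ m ih =>
    have hu : TendstoUniformlyOn g f atTop (cube d) :=
      (hc [] (Nat.zero_le _)).tendstoUniformlyOn_of_tendsto hf
    have hcons : ∀ i, ∃ h, HasPartial i f h ∧ MemCm d m h ∧
        ∀ w : List (Fin d), w.length ≤ m →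
          TendstoUniformlyOn (fun n => wordDeriv w (pd d i (g n))) (wordDeriv w h) atTop
            (cube d) := by
      intro i
      have hci : ∀ w : List (Fin d), w.length ≤ m →
          UniformCauchySeqOn (fun n => wordDeriv w (pd d i (g n))) atTop (cube d) :=
        fun w hw => hc (i :: w) (by simpa using hw)
      obtain ⟨h, hh⟩ := (hci [] (Nat.zero_le _)).exists_tendstoUniformlyOn
      have := ih (fun n => (hg n).pd i) hci fun x hx => hh.tendsto_at hx
      exact ⟨h, HasPartial.of_tendstoUniformlyOn (fun n => (hg n).hasPartial i)
        (fun n => ((hg n).pd i).continuousOn) hf hh, this⟩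
    refine ⟨memCm_succ_of_hasPartial
      (hu.continuousOn (Frequently.of_forall fun n => (hg n).continuousOn))
      fun i => let ⟨h, hp, hm, _⟩ := hcons i; ⟨h, hp, hm⟩, fun w hw => ?_⟩
    cases w with
    | nil => exact hu
    | cons i w =>
      obtain ⟨h, hp, -, ht⟩ := hcons i
      exact (ht w (by simpa using hw)).congr_right (wordDeriv_congr w hp.pd_eqOn.symm)

/-! ### Interpolation -/

/-- A Landau type interpolation inequality on the cube. -/
lemma abs_pd_le_interpolation {g : (Fin d → ℝ) → ℝ} (hg : MemCm d 2 g) (i : Fin d)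
    {δ M h : ℝ} (hδ : ∀ x ∈ cube d, |g x| ≤ δ) (hM : ∀ x ∈ cube d, |pd d i (pd d i g) x| ≤ M)
    (h0 : 0 < h) (h1 : h ≤ 1 / 2) : ∀ x ∈ cube d, |pd d i g x| ≤ 2 * δ / h + M * h := by
  have hM0 : 0 ≤ M := (abs_nonneg _).trans (hM 0 zero_mem_cube)
  have key : ∀ x ∈ cube d, ∀ a b, a ∈ Set.Icc (0 : ℝ) 1 → b ∈ Set.Icc (0 : ℝ) 1 → b - a = h →
      x i ∈ Set.Icc a b → |pd d i g x| ≤ 2 * δ / h + M * h := by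
    intro x hx a b ha hb hab hxi
    have hsub : Set.Icc a b ⊆ Set.Icc (0 : ℝ) 1 := Set.Icc_subset_Icc ha.1 hb.2
    obtain ⟨c, hc, hcs⟩ := exists_hasDerivAt_eq_slope (fun t => g (Function.update x i t))
      (fun t => pd d i g (Function.update x i t)) (by linarith : a < b)
      ((hg.continuousOn.comp_update hx i).mono hsub) (fun t ht =>
        ((hg.hasPartial i).hasDerivWithinAt hx (hsub ⟨ht.1.le, ht.2.le⟩)).hasDerivAt
          (Icc_mem_nhds (ha.1.trans_lt ht.1) (ht.2.trans_le hb.2)))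
    have hc' : c ∈ Set.Icc (0 : ℝ) 1 := hsub ⟨hc.1.le, hc.2.le⟩
    have hslope : |pd d i g (Function.update x i c)| ≤ 2 * δ / h := by
      rw [hcs, hab, abs_div, abs_of_pos h0]
      gcongr
      refine (abs_sub _ _).trans ?_
      linarith [hδ _ (update_mem_cube hx i ha), hδ _ (update_mem_cube hx i hb)]
    have hdiff : |pd d i g x - pd d i g (Function.update x i c)| ≤ M * h := by
      have := (convex_Icc (0 : ℝ) 1).norm_image_sub_le_of_norm_hasDerivWithin_le (C := M)
        (f := fun t => pd d i g (Function.update x i t))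
        (fun t ht => ((hg.pd i).hasPartial i).hasDerivWithinAt hx ht)
        (fun t ht => hM _ (update_mem_cube hx i ht)) hc' (hsub hxi)
      simp only [Function.update_eq_self, Real.norm_eq_abs] at this
      refine this.trans ?_
      gcongr
      rw [abs_le]
      constructor <;> linarith [hc.1, hc.2, hxi.1, hxi.2]
    have := abs_add_le (pd d i g x - pd d i g (Function.update x i c))
      (pd d i g (Function.update x i c))
    rw [sub_add_cancel] at this
    linarith
  intro x hx
  have hxi := mem_cube_iff.1 hx i
  rcases le_total (x i) (1 / 2) with hle | hle
  · exact key x hx (x i) (x i + h) hxi ⟨by linarith [hxi.1], by linarith⟩ (by ring)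
      ⟨le_rfl, by linarith⟩
  · exact key x hx (x i - h) (x i) ⟨by linarith, by linarith [hxi.2]⟩ hxi (by ring)
      ⟨by linarith, le_rfl⟩

lemma uniformCauchySeqOn_cube_iff {g : ℕ → (Fin d → ℝ) → ℝ} :
    UniformCauchySeqOn g atTop (cube d) ↔
      ∀ ε > 0, ∃ N, ∀ n ≥ N, ∀ k ≥ N, ∀ x ∈ cube d, |(g n - g k) x| ≤ ε := by
  rw [Metric.uniformCauchySeqOn_iff]
  simp only [Real.dist_eq, Pi.sub_apply]
  refine ⟨fun H ε hε => ?_, fun H ε hε => ?_⟩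
  · obtain ⟨N, hN⟩ := H ε hε
    exact ⟨N, fun n hn k hk x hx => (hN n hn k hk x hx).le⟩
  · obtain ⟨N, hN⟩ := H (ε / 2) (half_pos hε)
    exact ⟨N, fun n hn k hk x hx => (hN n hn k hk x hx).trans_lt (half_lt_self hε)⟩

lemma uniformCauchySeqOn_pd {g : ℕ → (Fin d → ℝ) → ℝ} {M : ℝ} {i : Fin d}
    (hg : ∀ n, MemCm d 2 (g n)) (hM : ∀ n, ∀ x ∈ cube d, |pd d i (pd d i (g n)) x| ≤ M)
    (hc : UniformCauchySeqOn g atTop (cube d)) :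
    UniformCauchySeqOn (fun n => pd d i (g n)) atTop (cube d) := by
  have hM0 : 0 ≤ M := (abs_nonneg _).trans (hM 0 0 zero_mem_cube)
  rw [uniformCauchySeqOn_cube_iff] at hc ⊢
  intro ε hε
  obtain ⟨h, h0, h1, hh⟩ : ∃ h : ℝ, 0 < h ∧ h ≤ 1 / 2 ∧ 2 * M * h ≤ ε / 2 := by
    refine ⟨min (1 / 2) (ε / (4 * (M + 1))), by positivity, min_le_left _ _, ?_⟩
    calc 2 * M * min (1 / 2) (ε / (4 * (M + 1))) ≤ 2 * (M + 1) * (ε / (4 * (M + 1))) := by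
          gcongr
          · linarith
          · exact min_le_right _ _
      _ = ε / 2 := by field_simp; norm_num
  obtain ⟨N, hN⟩ := hc (ε * h / 4) (by positivity)
  refine ⟨N, fun n hn k hk x hx => ?_⟩
  have hsub := (hg n).sub (hg k)
  have h2 : ∀ x ∈ cube d, |pd d i (pd d i (g n - g k)) x| ≤ 2 * M := by
    intro x hx
    have := wordDeriv_sub (w := [i, i]) le_rfl (hg n) (hg k) hx
    simp only [wordDeriv, Pi.sub_apply] at this
    rw [this]
    refine (abs_sub _ _).trans ?_
    linarith [hM n x hx, hM k x hx]
  have h3 := abs_pd_le_interpolation hsub i (hN n hn k hk) h2 h0 h1 x hx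
  have h4 := wordDeriv_sub (w := [i]) (by simp) (hg n) (hg k) hx
  simp only [wordDeriv] at h4
  rw [h4] at h3
  refine h3.trans ?_
  have : 2 * (ε * h / 4) / h = ε / 2 := by field_simp; norm_num
  linarith

/-- A uniformly Cauchy sequence which is bounded in `C^{m+1}` is Cauchy in `C^m`. -/
lemma uniformCauchySeqOn_wordDeriv {m : ℕ} {g : ℕ → (Fin d → ℝ) → ℝ} {M : ℝ}
    (hg : ∀ n, MemCm d (m + 1) (g n))
    (hM : ∀ n, ∀ w : List (Fin d), w.length ≤ m + 1 → ∀ x ∈ cube d, |wordDeriv w (g n) x| ≤ M)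
    (hc : UniformCauchySeqOn g atTop (cube d)) (w : List (Fin d)) (hw : w.length ≤ m) :
    UniformCauchySeqOn (fun n => wordDeriv w (g n)) atTop (cube d) := by
  induction w generalizing m g with
  | nil => exact hc
  | cons i w ih =>
    obtain _ | m := m
    · simp at hw
    · refine ih (fun n => (hg n).pd i) (fun n v hv => hM n (i :: v) (by simpa using hv)) ?_
        (by simpa using hw)
      exact uniformCauchySeqOn_pd (fun n => (hg n).of_le (by omega))
        (fun n => hM n [i, i] (by simp)) hc

/-! ### Smooth functions -/

lemma hasPartial_of_contDiff {g : (Fin d → ℝ) → ℝ} (hg : ContDiff ℝ ∞ g) (i : Fin d) :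
    HasPartial i g (fun x => fderiv ℝ g x (Pi.single i 1)) := by
  intro x _
  have h1 : HasFDerivAt g (fderiv ℝ g x) (Function.update x i (x i)) := by
    rw [Function.update_eq_self]
    exact (hg.differentiable (by simp) x).hasFDerivAt
  exact (h1.comp_hasDerivAt (x i) (hasDerivAt_update x i (x i))).hasDerivWithinAt

lemma contDiff_fderiv_single {g : (Fin d → ℝ) → ℝ} (hg : ContDiff ℝ ∞ g) (i : Fin d) :
    ContDiff ℝ ∞ (fun x => fderiv ℝ g x (Pi.single i 1)) :=
  (hg.fderiv_right (by simp)).clm_apply contDiff_const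

lemma memCm_of_contDiff {g : (Fin d → ℝ) → ℝ} (hg : ContDiff ℝ ∞ g) (m : ℕ) : MemCm d m g := by
  induction m generalizing g with
  | zero => exact hg.continuous.continuousOn
  | succ m ih =>
    exact memCm_succ_of_hasPartial hg.continuous.continuousOn fun i =>
      ⟨_, hasPartial_of_contDiff hg i, ih (contDiff_fderiv_single hg i)⟩

lemma pd_pd_comm_of_contDiff {g : (Fin d → ℝ) → ℝ} (hg : ContDiff ℝ ∞ g) (i j : Fin d) :
    Set.EqOn (pd d i (pd d j g)) (pd d j (pd d i g)) (cube d) := by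
  have key : ∀ k l : Fin d, Set.EqOn (pd d k (pd d l g))
      (fun x => fderiv ℝ (fderiv ℝ g) x (Pi.single k 1) (Pi.single l 1)) (cube d) := by
    intro k l x hx
    rw [pd_congr (hasPartial_of_contDiff hg l).pd_eqOn k hx,
      (hasPartial_of_contDiff (contDiff_fderiv_single hg l) k).pd_eqOn hx]
    have hd : DifferentiableAt ℝ (fderiv ℝ g) x :=
      (hg.fderiv_right (m := ∞) (by simp)).differentiable (by simp) x
    simp [fderiv_clm_apply hd (differentiableAt_const _)]
  intro x hx
  rw [key i j hx, key j i hx]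
  have h2 : minSmoothness ℝ 2 ≤ ∞ := by
    rw [minSmoothness_of_isRCLikeNormedField]
    exact WithTop.coe_le_coe.2 le_top
  exact (hg.contDiffAt.isSymmSndFDerivAt h2).eq _ _

/-! ### Smooth approximation -/

/-- The nearest point projection onto the cube. -/
def clampCube (x : Fin d → ℝ) : Fin d → ℝ := fun i => max 0 (min 1 (x i))

lemma clampCube_mem (x : Fin d → ℝ) : clampCube x ∈ cube d :=
  mem_cube_iff.2 fun _ => ⟨le_max_left _ _, max_le zero_le_one (min_le_left _ _)⟩

lemma clampCube_of_mem {x : Fin d → ℝ} (hx : x ∈ cube d) : clampCube x = x := by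
  ext i
  have := mem_cube_iff.1 hx i
  simp [clampCube, this.1, this.2]

/-- The continuous extension of a function on the cube which is constant along the fibres of
the nearest point projection. -/
def cubeExt (f : (Fin d → ℝ) → ℝ) : (Fin d → ℝ) → ℝ := fun x => f (clampCube x)

lemma cubeExt_eqOn (f : (Fin d → ℝ) → ℝ) : Set.EqOn (cubeExt f) f (cube d) := fun x hx => by
  rw [cubeExt, clampCube_of_mem hx]

lemma continuous_cubeExt {f : (Fin d → ℝ) → ℝ} (hf : ContinuousOn f (cube d)) :
    Continuous (cubeExt f) :=
  hf.comp_continuous (by unfold clampCube; fun_prop) clampCube_mem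

lemma HasPartial.cubeExt {i : Fin d} {f h : (Fin d → ℝ) → ℝ} (H : HasPartial i f h) :
    HasPartial i (cubeExt f) (cubeExt h) := by
  intro x hx
  rw [cubeExt_eqOn h hx]
  exact (H x hx).congr (fun t ht => cubeExt_eqOn f (update_mem_cube hx i ht))
    (cubeExt_eqOn f (update_mem_cube hx i (mem_cube_iff.1 hx i)))

/-- The contraction of the cube towards its centre with ratio `1 - a`. -/
def shrinkCube (a : ℝ) (x : Fin d → ℝ) : Fin d → ℝ := fun i => (1 - a) * x i + a / 2

lemma shrinkCube_update (a : ℝ) (x u : Fin d → ℝ) (i : Fin d) (t : ℝ) :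
    shrinkCube a (Function.update x i t) - u =
      Function.update (shrinkCube a x - u) i ((1 - a) * t + (a / 2 - u i)) := by
  ext j
  rcases eq_or_ne j i with rfl | hj
  · simp [shrinkCube]; ring
  · simp [shrinkCube, hj]

lemma shrinkCube_sub_mem {a : ℝ} (ha : a ≤ 1) {x u : Fin d → ℝ} (hx : x ∈ cube d)
    (hu : ‖u‖ ≤ a / 2) : shrinkCube a x - u ∈ cube d := by
  rw [mem_cube_iff] at hx ⊢
  intro i
  have h1 := abs_le.1 ((Real.norm_eq_abs _ ▸ norm_le_pi_norm u i).trans hu)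
  have h2 := hx i
  simp only [shrinkCube, Pi.sub_apply]
  constructor
  · nlinarith [h1.2, mul_nonneg (sub_nonneg.2 ha) h2.1]
  · nlinarith [h1.1, mul_nonneg (sub_nonneg.2 ha) (sub_nonneg.2 h2.2)]

lemma dist_shrinkCube_le {a : ℝ} (ha : 0 ≤ a) {x : Fin d → ℝ} (hx : x ∈ cube d) :
    dist (shrinkCube a x) x ≤ a / 2 := by
  refine (dist_pi_le_iff (by linarith)).2 fun i => ?_
  have h := mem_cube_iff.1 hx i
  rw [Real.dist_eq, abs_le, shrinkCube]
  constructor <;> nlinarith [mul_nonneg ha h.1, mul_nonneg ha (sub_nonneg.2 h.2)]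

/-- Mollification of a function on the cube, composed with a contraction of the cube which keeps
the averages inside the cube. -/
def mollify (φ : ContDiffBump (0 : Fin d → ℝ)) (a : ℝ) (f : (Fin d → ℝ) → ℝ) (x : Fin d → ℝ) : ℝ :=
  (φ.normed volume ⋆[ContinuousLinearMap.lsmul ℝ ℝ, volume] cubeExt f) (shrinkCube a x)

lemma mollify_apply (φ : ContDiffBump (0 : Fin d → ℝ)) (a : ℝ) (f : (Fin d → ℝ) → ℝ)
    (x : Fin d → ℝ) :
    mollify φ a f x = ∫ u, φ.normed volume u * cubeExt f (shrinkCube a x - u) := rfl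

lemma contDiff_mollify (φ : ContDiffBump (0 : Fin d → ℝ)) (a : ℝ) {f : (Fin d → ℝ) → ℝ}
    (hf : ContinuousOn f (cube d)) : ContDiff ℝ ∞ (mollify φ a f) := by
  have h : ContDiff ℝ ∞
      (φ.normed volume ⋆[ContinuousLinearMap.lsmul ℝ ℝ, volume] cubeExt f) :=
    φ.hasCompactSupport_normed.contDiff_convolution_left _ φ.contDiff_normed
      (continuous_cubeExt hf).locallyIntegrable
  exact h.comp (by unfold shrinkCube; fun_prop)

lemma integrable_mollify (φ : ContDiffBump (0 : Fin d → ℝ)) {f : (Fin d → ℝ) → ℝ}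
    (hf : ContinuousOn f (cube d)) (x : Fin d → ℝ) :
    Integrable (fun u => φ.normed volume u * cubeExt f (x - u)) :=
  have hc : Continuous fun u => φ.normed volume u * cubeExt f (x - u) :=
    φ.continuous_normed.mul ((continuous_cubeExt hf).comp (by fun_prop))
  hc.integrable_of_hasCompactSupport φ.hasCompactSupport_normed.mul_right

lemma hasPartial_mollify {φ : ContDiffBump (0 : Fin d → ℝ)} {a : ℝ} (ha : a ≤ 1)
    (hφ : φ.rOut ≤ a / 2) {i : Fin d} {f h : (Fin d → ℝ) → ℝ} (hf : ContinuousOn f (cube d))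
    (hh : ContinuousOn h (cube d)) (H : HasPartial i f h) :
    HasPartial i (mollify φ a f) ((1 - a) • mollify φ a h) := by
  have hHc : Continuous (cubeExt h) := continuous_cubeExt hh
  rw [hasPartial_iff_integral ((contDiff_mollify φ a hh).continuous.const_smul _).continuousOn]
  intro x hx t ht
  have hline : ∀ u : Fin d → ℝ, ‖u‖ ≤ a / 2 →
      ∫ s in (0 : ℝ)..t, (1 - a) * cubeExt h (shrinkCube a (Function.update x i s) - u) =
        cubeExt f (shrinkCube a (Function.update x i t) - u) -
          cubeExt f (shrinkCube a (Function.update x i 0) - u) := by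
    intro u hu
    have hy := shrinkCube_sub_mem ha hx hu
    have hmem : ∀ s ∈ Set.Icc (0 : ℝ) 1, (1 - a) * s + (a / 2 - u i) ∈ Set.Icc (0 : ℝ) 1 := by
      intro s hs
      have := mem_cube_iff.1 (shrinkCube_sub_mem ha (update_mem_cube hx i hs) hu) i
      rwa [shrinkCube_update, Function.update_self] at this
    have hint : ∀ b c : ℝ, IntervalIntegrable
        (fun s => cubeExt h (Function.update (shrinkCube a x - u) i s)) volume b c := fun b c =>
      (hHc.comp (by fun_prop)).intervalIntegrable _ _
    have hftc := (hasPartial_iff_integral hHc.continuousOn).1 H.cubeExt _ hy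
    simp only [shrinkCube_update]
    rw [intervalIntegral.integral_const_mul,
      intervalIntegral.mul_integral_comp_mul_add
        (f := fun s => cubeExt h (Function.update (shrinkCube a x - u) i s)),
      ← intervalIntegral.integral_interval_sub_left (hint 0 _) (hint 0 _),
      hftc _ (hmem t ht), hftc _ (hmem 0 (by simp))]
    ring
  obtain ⟨C, hC0, hC⟩ := exists_abs_le_of_continuousOn_cube hh
  have hswap : Integrable (Function.uncurry fun (s : ℝ) (u : Fin d → ℝ) =>
      φ.normed volume u * ((1 - a) * cubeExt h (shrinkCube a (Function.update x i s) - u)))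
      ((volume.restrict (Set.uIoc 0 t)).prod volume) := by
    have : IsFiniteMeasure (volume.restrict (Set.uIoc 0 t)) := ⟨by simp [Set.uIoc]⟩
    refine Integrable.mono' (g := fun z => |1 - a| * C * φ.normed volume z.2) ?_ ?_ ?_
    · exact (φ.integrable_normed.comp_snd _).const_mul _
    · have hφc := φ.continuous_normed (μ := volume)
      refine Continuous.aestronglyMeasurable ?_
      unfold Function.uncurry shrinkCube
      fun_prop
    · refine Eventually.of_forall fun z => ?_
      have hz := hC _ (clampCube_mem (shrinkCube a (Function.update x i z.1) - z.2))
      simp only [Function.uncurry, norm_mul, Real.norm_eq_abs, abs_of_nonneg (φ.nonneg_normed _)]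
      rw [mul_comm]
      gcongr
      · exact φ.nonneg_normed _
      · exact hz
  calc ∫ s in (0 : ℝ)..t, ((1 - a) • mollify φ a h) (Function.update x i s)
      = ∫ s in (0 : ℝ)..t, ∫ u, φ.normed volume u *
          ((1 - a) * cubeExt h (shrinkCube a (Function.update x i s) - u)) := by
        refine intervalIntegral.integral_congr fun s _ => ?_
        simp only [Pi.smul_apply, smul_eq_mul, mollify_apply, ← integral_const_mul]
        congr 1
        ext u
        ring
    _ = ∫ u, φ.normed volume u * (cubeExt f (shrinkCube a (Function.update x i t) - u) -
          cubeExt f (shrinkCube a (Function.update x i 0) - u)) := by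
        rw [intervalIntegral_integral_swap hswap]
        congr 1
        ext u
        rw [intervalIntegral.integral_const_mul]
        by_cases hu : φ.normed volume u = 0
        · simp [hu]
        · have hu' : u ∈ Metric.ball (0 : Fin d → ℝ) φ.rOut :=
            φ.support_normed_eq (μ := volume) ▸ hu
          rw [hline u ((mem_ball_zero_iff.1 hu').le.trans hφ)]
    _ = _ := by
        simp only [mollify_apply, mul_sub]
        exact integral_sub (integrable_mollify φ hf _) (integrable_mollify φ hf _)

lemma wordDeriv_mollify {φ : ContDiffBump (0 : Fin d → ℝ)} {a : ℝ} (ha : a ≤ 1)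
    (hφ : φ.rOut ≤ a / 2) {m : ℕ} {f : (Fin d → ℝ) → ℝ} (hf : MemCm d m f) {w : List (Fin d)}
    (hw : w.length ≤ m) :
    Set.EqOn (wordDeriv w (mollify φ a f)) ((1 - a) ^ w.length • mollify φ a (wordDeriv w f))
      (cube d) := by
  induction w generalizing m f with
  | nil => intro x _; simp [wordDeriv]
  | cons i w ih =>
    obtain _ | m := m
    · simp at hw
    · intro x hx
      have h1 := (hasPartial_mollify ha hφ hf.continuousOn (hf.pd i).continuousOn
        (hf.hasPartial i)).pd_eqOn
      simp only [wordDeriv, List.length_cons]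
      rw [wordDeriv_congr w h1 hx, wordDeriv_const_smul, pow_succ', mul_smul]
      simp only [Pi.smul_apply, ih (hf.pd i) (by simpa using hw) hx]

lemma abs_mollify_sub_le {φ : ContDiffBump (0 : Fin d → ℝ)} {a : ℝ} (ha0 : 0 ≤ a) (ha : a ≤ 1)
    (hφ : φ.rOut ≤ a / 2) {f : (Fin d → ℝ) → ℝ} (hf : ContinuousOn f (cube d)) {η : ℝ}
    (hη : ∀ x ∈ cube d, ∀ y ∈ cube d, dist x y ≤ a / 2 → dist (f x) (f y) ≤ η)
    {x : Fin d → ℝ} (hx : x ∈ cube d) : |mollify φ a f x - f x| ≤ 2 * η := by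
  have hy : shrinkCube a x ∈ cube d := by
    simpa using shrinkCube_sub_mem ha hx (u := 0) (by simpa using div_nonneg ha0 zero_le_two)
  have h1 : dist (mollify φ a f x) (cubeExt f (shrinkCube a x)) ≤ η := by
    refine φ.dist_normed_convolution_le (continuous_cubeExt hf).aestronglyMeasurable
      fun z hz => ?_
    have hz' : dist z (shrinkCube a x) ≤ a / 2 := (Metric.mem_ball.1 hz).le.trans hφ
    have hzc : z ∈ cube d := by
      have := shrinkCube_sub_mem ha hx (u := shrinkCube a x - z)
        (by rwa [← dist_eq_norm, dist_comm])
      rwa [sub_sub_cancel] at this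
    rw [cubeExt_eqOn f hzc, cubeExt_eqOn f hy]
    exact hη z hzc _ hy hz'
  rw [cubeExt_eqOn f hy] at h1
  rw [← Real.dist_eq]
  linarith [dist_triangle (mollify φ a f x) (f (shrinkCube a x)) (f x),
    hη _ hy x hx (dist_shrinkCube_le ha0 hx)]

/-- Every function of class `C^m` on the cube is the limit in `C^m` of smooth functions. -/
lemma exists_contDiff_tendsto {m : ℕ} {f : (Fin d → ℝ) → ℝ} (hf : MemCm d m f) :
    ∃ g : ℕ → (Fin d → ℝ) → ℝ, (∀ n, ContDiff ℝ ∞ (g n)) ∧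
      ∀ w : List (Fin d), w.length ≤ m →
        TendstoUniformlyOn (fun n => wordDeriv w (g n)) (wordDeriv w f) atTop (cube d) := by
  let a : ℕ → ℝ := fun n => 1 / ((n : ℝ) + 1)
  have ha0 : ∀ n, 0 < a n := fun n => by positivity
  have ha1 : ∀ n, a n ≤ 1 := fun n => (div_le_one (by positivity)).2 (by simp)
  have hat : Tendsto a atTop (𝓝 0) := tendsto_one_div_add_atTop_nhds_zero_nat
  let φ : ℕ → ContDiffBump (0 : Fin d → ℝ) := fun n =>
    ⟨a n / 4, a n / 2, by have := ha0 n; positivity, by linarith [ha0 n]⟩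
  have hφ : ∀ n, (φ n).rOut ≤ a n / 2 := fun n => le_rfl
  refine ⟨fun n => mollify (φ n) (a n) f, fun n => contDiff_mollify _ _ hf.continuousOn,
    fun w hw => ?_⟩
  have hc := hf.continuousOn_wordDeriv hw
  obtain ⟨C, hC0, hC⟩ := exists_abs_le_of_continuousOn_cube hc
  rw [Metric.tendstoUniformlyOn_iff]
  intro ε hε
  obtain ⟨δ, hδ, hu⟩ := Metric.uniformContinuousOn_iff.1
    ((isCompact_cube d).uniformContinuousOn_of_continuous hc) (ε / 6) (by positivity)
  have hpow : Tendsto (fun n => |(1 - a n) ^ w.length - 1| * C) atTop (𝓝 0) := by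
    have : Tendsto (fun n => |(1 - a n) ^ w.length - 1| * C) atTop
        (𝓝 (|(1 - 0) ^ w.length - 1| * C)) :=
      (((tendsto_const_nhds.sub hat).pow _).sub_const _).abs.mul_const _
    simpa using this
  filter_upwards [hat.eventually_lt_const hδ, hpow.eventually_lt_const (half_pos hε)]
    with n hn hn2 x hx
  have h1 := abs_mollify_sub_le (ha0 n).le (ha1 n) (hφ n) hc (η := ε / 6)
    (fun y hy z hz hyz => (hu y hy z hz (by linarith [ha0 n])).le) hx
  rw [dist_comm, Real.dist_eq, wordDeriv_mollify (ha1 n) (hφ n) hf hw hx]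
  set c := (1 - a n) ^ w.length
  have hc1 : |c| ≤ 1 := by
    rw [abs_of_nonneg (pow_nonneg (by linarith [ha1 n]) _)]
    exact pow_le_one₀ (by linarith [ha1 n]) (by linarith [ha0 n])
  calc |(c • mollify (φ n) (a n) (wordDeriv w f)) x - wordDeriv w f x|
      = |c * (mollify (φ n) (a n) (wordDeriv w f) x - wordDeriv w f x) +
          (c - 1) * wordDeriv w f x| := by
        simp only [Pi.smul_apply, smul_eq_mul]; congr 1; ring
    _ ≤ |c| * |mollify (φ n) (a n) (wordDeriv w f) x - wordDeriv w f x| +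
          |c - 1| * |wordDeriv w f x| := by
        rw [← abs_mul, ← abs_mul]; exact abs_add_le _ _
    _ ≤ 1 * (2 * (ε / 6)) + |c - 1| * C := by
        gcongr
        exact hC x hx
    _ < ε := by linarith

/-! ### Symmetry of mixed derivatives and the `C^m`-norm -/

lemma MemCm.pd_pd_comm {f : (Fin d → ℝ) → ℝ} (hf : MemCm d 2 f) (i j : Fin d) :
    Set.EqOn (_root_.pd d i (_root_.pd d j f)) (_root_.pd d j (_root_.pd d i f)) (cube d) := by
  obtain ⟨g, hg, hgf⟩ := exists_contDiff_tendsto hf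
  intro x hx
  have h1 := (hgf [j, i] le_rfl).tendsto_at hx
  have h2 := (hgf [i, j] le_rfl).tendsto_at hx
  exact tendsto_nhds_unique h1 (h2.congr fun n => (pd_pd_comm_of_contDiff (hg n) i j hx).symm)

lemma MemCm.wordDeriv_perm {m : ℕ} {f : (Fin d → ℝ) → ℝ} (hf : MemCm d m f)
    {v w : List (Fin d)} (h : v.Perm w) (hv : v.length ≤ m) :
    Set.EqOn (_root_.wordDeriv v f) (_root_.wordDeriv w f) (cube d) := by
  induction h generalizing m f with
  | nil => exact fun _ _ => rfl
  | cons i _ ih =>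
    obtain _ | m := m
    · simp at hv
    · exact ih (hf.pd i) (by simpa using hv)
  | swap i j l =>
    exact wordDeriv_congr l ((hf.of_le (by simp at hv; omega)).pd_pd_comm i j)
  | trans h₁ _ ih₁ ih₂ => exact (ih₁ hf hv).trans (ih₂ hf (h₁.length_eq ▸ hv))

instance finite_multiIndex (d m : ℕ) : Finite {α : Fin d → ℕ // (∑ i, α i) ≤ m} := by
  refine ((Set.finite_Iic (fun _ : Fin d => m)).subset fun α hα i => ?_).to_subtype
  exact (Finset.single_le_sum (fun _ _ => Nat.zero_le _) (Finset.mem_univ i)).trans hα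

lemma MemCm.abs_wordDeriv_le {m : ℕ} {f : (Fin d → ℝ) → ℝ} (hf : MemCm d m f)
    {w : List (Fin d)} (hw : w.length ≤ m) {x : Fin d → ℝ} (hx : x ∈ cube d) :
    |_root_.wordDeriv w f x| ≤ CmNorm d m f := by
  obtain ⟨v, hv, hcount⟩ := exists_word_mderiv fun i => w.count i
  have hperm : w.Perm v := List.perm_iff_count.2 fun i => (hcount i).symm
  rw [hf.wordDeriv_perm hperm hw hx]
  refine (abs_le_supCube (hf.continuousOn_wordDeriv (hperm.length_eq ▸ hw)) hx).trans ?_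
  rw [← hv]
  exact le_ciSup (f := fun α : {α : Fin d → ℕ // (∑ i, α i) ≤ m} => supCube d (mderiv d α.1 f))
    (Set.finite_range _).bddAbove ⟨fun i => w.count i, length_eq_sum_count w ▸ hw⟩

lemma CmNorm_le {m : ℕ} {f : (Fin d → ℝ) → ℝ} {C : ℝ}
    (h : ∀ w : List (Fin d), w.length ≤ m → ∀ x ∈ cube d, |wordDeriv w f x| ≤ C) :
    CmNorm d m f ≤ C := by
  have : Nonempty {α : Fin d → ℕ // (∑ i, α i) ≤ m} := ⟨⟨0, by simp⟩⟩
  refine ciSup_le fun α => supCube_le fun x hx => ?_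
  obtain ⟨w, hw, hcount⟩ := exists_word_mderiv α.1
  rw [hw]
  refine h w ?_ x hx
  rw [length_eq_sum_count]
  simpa only [hcount] using α.2

/-- Convergence of all derivatives up to order `m` is convergence in the `C^m`-norm. -/
lemma eventually_CmNorm_sub_le {m : ℕ} {g : ℕ → (Fin d → ℝ) → ℝ} {f : (Fin d → ℝ) → ℝ}
    (hg : ∀ n, MemCm d m (g n)) (hf : MemCm d m f)
    (h : ∀ w : List (Fin d), w.length ≤ m →
      TendstoUniformlyOn (fun n => wordDeriv w (g n)) (wordDeriv w f) atTop (cube d))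
    {ε : ℝ} (hε : 0 < ε) : ∀ᶠ n in atTop, CmNorm d m (g n - f) ≤ ε := by
  have hall : ∀ᶠ n in atTop, ∀ w ∈ {w : List (Fin d) | w.length ≤ m}, ∀ x ∈ cube d,
      dist (wordDeriv w f x) (wordDeriv w (g n) x) < ε :=
    (eventually_all_finite (List.finite_length_le (Fin d) m)).2 fun w hw =>
      Metric.tendstoUniformlyOn_iff.1 (h w hw) ε hε
  filter_upwards [hall] with n hn
  refine CmNorm_le fun w hw x hx => ?_
  rw [wordDeriv_sub hw (hg n) hf hx, Pi.sub_apply, ← Real.dist_eq, dist_comm]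
  exact (hn w hw x hx).le

lemma CmNorm_le_add {m : ℕ} {f g : (Fin d → ℝ) → ℝ} (hf : MemCm d m f) (hg : MemCm d m g) :
    CmNorm d m g ≤ CmNorm d m f + CmNorm d m (g - f) := by
  refine CmNorm_le fun w hw x hx => ?_
  have h1 := hf.abs_wordDeriv_le hw hx
  have h2 := (hg.sub hf).abs_wordDeriv_le hw hx
  rw [wordDeriv_sub hw hg hf hx, Pi.sub_apply] at h2
  have h3 := abs_add_le (wordDeriv w f x) (wordDeriv w g x - wordDeriv w f x)
  rw [add_sub_cancel] at h3
  linarith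

lemma CmNorm_sub_comm {m : ℕ} {f g : (Fin d → ℝ) → ℝ} (hf : MemCm d m f) (hg : MemCm d m g) :
    CmNorm d m (f - g) = CmNorm d m (g - f) := by
  have key : ∀ {f g : (Fin d → ℝ) → ℝ}, MemCm d m f → MemCm d m g →
      CmNorm d m (f - g) ≤ CmNorm d m (g - f) := by
    intro f g hf hg
    refine CmNorm_le fun w hw x hx => ?_
    have := (hg.sub hf).abs_wordDeriv_le hw hx
    rwa [wordDeriv_sub hw hg hf hx, Pi.sub_apply, abs_sub_comm, ← Pi.sub_apply,
      ← wordDeriv_sub hw hf hg hx] at this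
  exact le_antisymm (key hf hg) (key hg hf)

lemma abs_wordDeriv_le_of_tendsto {w : List (Fin d)} {g : ℕ → (Fin d → ℝ) → ℝ}
    {f : (Fin d → ℝ) → ℝ}
    (h : TendstoUniformlyOn (fun n => wordDeriv w (g n)) (wordDeriv w f) atTop (cube d)) {C : ℝ}
    (hC : ∀ᶠ n in atTop, ∀ x ∈ cube d, |wordDeriv w (g n) x| ≤ C) {x : Fin d → ℝ}
    (hx : x ∈ cube d) : |wordDeriv w f x| ≤ C :=
  le_of_tendsto (h.tendsto_at hx).abs (hC.mono fun _ hn => hn x hx)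

/-! ### Limits of operators bounded in `C^m` -/

/-- If `u n → v` uniformly, with `u` bounded by `C` in `C^m` and by `C'` in `C^{m+1}`, then `v`
is of class `C^m` with `C^m`-norm at most `C`. -/
lemma memCm_and_CmNorm_le_of_tendsto {m : ℕ} {u : ℕ → (Fin d → ℝ) → ℝ} {v : (Fin d → ℝ) → ℝ}
    {C C' : ℝ} (hu : ∀ n, MemCm d (m + 1) (u n)) (hC : ∀ n, CmNorm d m (u n) ≤ C)
    (hC' : ∀ n, CmNorm d (m + 1) (u n) ≤ C') (hv : TendstoUniformlyOn u v atTop (cube d)) :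
    MemCm d m v ∧ CmNorm d m v ≤ C := by
  have hc := uniformCauchySeqOn_wordDeriv hu
    (fun n w hw x hx => ((hu n).abs_wordDeriv_le hw hx).trans (hC' n)) hv.uniformCauchySeqOn
  obtain ⟨hvm, hlim⟩ := memCm_of_uniformCauchySeqOn (fun n => (hu n).of_succ) hc
    fun x hx => hv.tendsto_at hx
  refine ⟨hvm, CmNorm_le fun w hw x hx => abs_wordDeriv_le_of_tendsto (hlim w hw) ?_ hx⟩
  exact Eventually.of_forall fun n x hx => ((hu n).of_succ.abs_wordDeriv_le hw hx).trans (hC n)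

lemma tendstoUniformlyOn_cube_of_supCube {u : ℕ → (Fin d → ℝ) → ℝ} {v : (Fin d → ℝ) → ℝ}
    (hu : ∀ n, ContinuousOn (u n) (cube d)) (hv : ContinuousOn v (cube d))
    (h : Tendsto (fun n => supCube d (fun x => v x - u n x)) atTop (𝓝 0)) :
    TendstoUniformlyOn u v atTop (cube d) := by
  rw [Metric.tendstoUniformlyOn_iff]
  intro ε hε
  filter_upwards [h.eventually_lt_const hε] with n hn x hx
  exact (abs_le_supCube (f := fun x => v x - u n x) (hv.sub (hu n)) hx).trans_lt hn

/-- A linear map which is bounded on `C^{m+1}` with respect to the `C^m`-norm and contracts the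
supremum norm is bounded on `C^m`. -/
lemma memCm_and_CmNorm_le_of_dense {m : ℕ} {K : ℝ} (hK : 0 ≤ K)
    {T : ((Fin d → ℝ) → ℝ) → ((Fin d → ℝ) → ℝ)} (hT : IsLinearMap ℝ T)
    (hTC : ∀ g : (Fin d → ℝ) → ℝ, ContinuousOn g (cube d) → ContinuousOn (T g) (cube d))
    (hcontr : ∀ g : (Fin d → ℝ) → ℝ, ContinuousOn g (cube d) → supCube d (T g) ≤ supCube d g)
    (hTm : ∀ g, MemCm d (m + 1) g → MemCm d m (T g) ∧ CmNorm d m (T g) ≤ K * CmNorm d m g)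
    {f : (Fin d → ℝ) → ℝ} (hf : MemCm d m f) :
    MemCm d m (T f) ∧ CmNorm d m (T f) ≤ K * CmNorm d m f := by
  obtain ⟨g, hg, hgf⟩ := exists_contDiff_tendsto hf
  have hgm : ∀ n k, MemCm d k (g n) := fun n k => memCm_of_contDiff (hg n) k
  have hclose := fun {ε : ℝ} (hε : 0 < ε) =>
    eventually_CmNorm_sub_le (fun n => hgm n m) hf hgf hε
  have hTlim : ∀ x ∈ cube d, Tendsto (fun n => T (g n) x) atTop (𝓝 (T f x)) := by
    intro x hx
    refine (Metric.tendsto_nhds.2 fun ε hε => ?_)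
    filter_upwards [hclose (half_pos hε)] with n hn
    have hcont : ContinuousOn (g n - f) (cube d) := (hgm n 0).continuousOn.sub hf.continuousOn
    have h1 := abs_le_supCube (hTC _ hcont) hx
    have h2 : supCube d (g n - f) ≤ CmNorm d m (g n - f) := supCube_le fun y hy =>
      ((hgm n m).sub hf).abs_wordDeriv_le (w := []) (Nat.zero_le _) hy
    have h3 := hcontr _ hcont
    rw [hT.map_sub] at h1 h3
    rw [Real.dist_eq, ← Pi.sub_apply]
    linarith
  have hcauchy : ∀ w : List (Fin d), w.length ≤ m →
      UniformCauchySeqOn (fun n => wordDeriv w (T (g n))) atTop (cube d) := by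
    intro w hw
    rw [uniformCauchySeqOn_cube_iff]
    intro ε hε
    obtain ⟨N, hN⟩ := eventually_atTop.1 (hclose (ε := ε / (2 * (K + 1))) (by positivity))
    refine ⟨N, fun n hn k hk x hx => ?_⟩
    obtain ⟨hm, hle⟩ := hTm _ ((hgm n (m + 1)).sub (hgm k (m + 1)))
    have h1 := hm.abs_wordDeriv_le hw hx
    rw [hT.map_sub, wordDeriv_sub hw (hTm _ (hgm n _)).1 (hTm _ (hgm k _)).1 hx] at h1
    rw [hT.map_sub] at hle
    have h2 : CmNorm d m (g n - g k) ≤ ε / (2 * (K + 1)) + ε / (2 * (K + 1)) := by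
      have := CmNorm_le_add (hf.sub (hgm k m)) ((hgm n m).sub (hgm k m))
      rw [sub_sub_sub_cancel_right, CmNorm_sub_comm hf (hgm k m)] at this
      linarith [hN n hn, hN k hk]
    refine h1.trans (hle.trans ?_)
    calc K * CmNorm d m (g n - g k)
        ≤ (K + 1) * (ε / (2 * (K + 1)) + ε / (2 * (K + 1))) := by
          refine (mul_le_mul_of_nonneg_left h2 hK).trans ?_
          gcongr
          linarith
      _ = ε := by field_simp; norm_num
  obtain ⟨hTfm, hlim⟩ := memCm_of_uniformCauchySeqOn (fun n => (hTm _ (hgm n _)).1) hcauchy hTlim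
  refine ⟨hTfm, CmNorm_le fun w hw x hx => le_of_forall_pos_le_add fun ε hε => ?_⟩
  refine abs_wordDeriv_le_of_tendsto (hlim w hw) ?_ hx
  filter_upwards [hclose (ε := ε / (K + 1)) (by positivity)] with n hn y hy
  obtain ⟨hm, hle⟩ := hTm _ (hgm n (m + 1))
  refine (hm.abs_wordDeriv_le hw hy).trans (hle.trans ?_)
  calc K * CmNorm d m (g n) ≤ K * (CmNorm d m f + ε / (K + 1)) := by
        gcongr
        linarith [CmNorm_le_add hf (hgm n m)]
    _ = K * CmNorm d m f + K / (K + 1) * ε := by ring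
    _ ≤ K * CmNorm d m f + 1 * ε := by
        gcongr
        exact (div_le_one (by positivity)).2 (by linarith)
    _ = _ := by rw [one_mul]

end CubeCalculus

/-- Analytic core of the main theorem (Trotter approximation): if the linear sup-norm
contraction `T` on `C([0,1]^d,ℝ)` is the uniform limit of linear maps `U_n` which are
bounded on `C^m` by `K_m` and on `C^{m+1}` by `K_{m+1}`, then `T` maps `C^m([0,1]^d,ℝ)`
into itself with `‖Tf‖_{C^m} ≤ K_m ‖f‖_{C^m}`. -/
theorem Cm_bound_via_Trotter_approximation
    (d : ℕ) (hd : 0 < d) (m : ℕ) (hm : m ≤ 2)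
    (Km Km1 : ℝ) (hKm : 1 ≤ Km) (hKm1 : 1 ≤ Km1)
    (T : ((Fin d → ℝ) → ℝ) → ((Fin d → ℝ) → ℝ))
    (hlinT : IsLinearMap ℝ T)
    (hTC : ∀ g : (Fin d → ℝ) → ℝ, ContinuousOn g (cube d) → ContinuousOn (T g) (cube d))
    (hcontr : ∀ g : (Fin d → ℝ) → ℝ, ContinuousOn g (cube d) →
      supCube d (T g) ≤ supCube d g)
    (U : ℕ → ((Fin d → ℝ) → ℝ) → ((Fin d → ℝ) → ℝ))
    (hlinU : ∀ n : ℕ, IsLinearMap ℝ (U n))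
    (hUC : ∀ n : ℕ, ∀ g : (Fin d → ℝ) → ℝ, ContinuousOn g (cube d) →
      ContinuousOn (U n g) (cube d))
    (ha : ∀ n : ℕ, ∀ f : (Fin d → ℝ) → ℝ, MemCm d m f →
      MemCm d m (U n f) ∧ CmNorm d m (U n f) ≤ Km * CmNorm d m f)
    (hb : ∀ n : ℕ, ∀ f : (Fin d → ℝ) → ℝ, MemCm d (m + 1) f →
      MemCm d (m + 1) (U n f) ∧ CmNorm d (m + 1) (U n f) ≤ Km1 * CmNorm d (m + 1) f)
    (hc : ∀ f : (Fin d → ℝ) → ℝ, ContinuousOn f (cube d) →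
      Filter.Tendsto (fun n => supCube d (fun x => T f x - U n f x))
        Filter.atTop (nhds 0))
    (f : (Fin d → ℝ) → ℝ) (hf : MemCm d m f) :
    MemCm d m (T f) ∧ CmNorm d m (T f) ≤ Km * CmNorm d m f := by
  refine memCm_and_CmNorm_le_of_dense (zero_le_one.trans hKm) hlinT hTC hcontr (fun g hg => ?_) hf
  exact memCm_and_CmNorm_le_of_tendsto (fun n => (hb n g hg).1) (fun n => (ha n g hg.of_succ).2)
    (fun n => (hb n g hg).2)
    (tendstoUniformlyOn_cube_of_supCube (fun n => hUC n g hg.continuousOn)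
      (hTC g hg.continuousOn) (hc g hg.continuousOn))

end
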